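/- arXiv:2206.10236 — 7 statements merged into one kernel-verified Lean document; each statement's English description precedes it below -/
import Mathlib

section
/- Let F(x) = 1/(1+e^{-x}) be the logistic distribution function. For every real δ ≠ 0, setting θ = e^δ/(1+e^δ), one has for all x ≥ 0: F(x-δ) - F(-x-δ) = Σ_{n=1}^∞ (θ(1-θ)^n + (1-θ)θ^n) · (1-e^{-x})^n. -/
open Real

/-- The geometric series without its constant term. -/
theorem hasSum_pow_succ_of_lt_one {r : ℝ} (h₀ : 0 ≤ r) (h₁ : r < 1) :
    HasSum (fun n : ℕ => r ^ (n + 1)) (r / (1 - r)) := by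
  simpa only [pow_succ', div_eq_mul_inv] using (hasSum_geometric_of_lt_one h₀ h₁).mul_left r

/-- The generating function of the mixture, with weights `d / (1 + d)` and `1 / (1 + d)`, of the
geometric distributions on the positive integers with parameters `1 / (1 + d)` and
`d / (1 + d)`, evaluated at `1 - t`. -/
theorem hasSum_geometric_mixture {d t : ℝ} (hd : 0 < d) (ht₀ : 0 < t) (ht₁ : t ≤ 1) :
    HasSum (fun n : ℕ => (d / (1 + d) * (1 - d / (1 + d)) ^ (n + 1) +
        (1 - d / (1 + d)) * (d / (1 + d)) ^ (n + 1)) * (1 - t) ^ (n + 1))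
      (d * (1 - t ^ 2) / ((1 + t * d) * (t + d))) := by
  have hθ : 1 - d / (1 + d) = 1 / (1 + d) := by field_simp; ring
  have hu : 0 ≤ 1 - t := by linarith
  have h₁ : 1 / (1 + d) * (1 - t) < 1 := by
    rw [div_mul_eq_mul_div, div_lt_one (by positivity)]; linarith
  have h₂ : d / (1 + d) * (1 - t) < 1 := by
    rw [div_mul_eq_mul_div, div_lt_one (by positivity)]; nlinarith
  rw [hθ]
  have h := ((hasSum_pow_succ_of_lt_one (by positivity) h₁).mul_left (d / (1 + d))).add
    ((hasSum_pow_succ_of_lt_one (by positivity) h₂).mul_left (1 / (1 + d)))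
  have e₁ : 1 - 1 / (1 + d) * (1 - t) = (t + d) / (1 + d) := by field_simp; ring
  have e₂ : 1 - d / (1 + d) * (1 - t) = (1 + t * d) / (1 + d) := by field_simp; ring
  rw [e₁, e₂] at h
  have e : d * (1 - t ^ 2) / ((1 + t * d) * (t + d)) =
      d / (1 + d) * (1 / (1 + d) * (1 - t) / ((t + d) / (1 + d))) +
        1 / (1 + d) * (d / (1 + d) * (1 - t) / ((1 + t * d) / (1 + d))) := by
    field_simp
    ring
  rw [e]
  simpa only [mul_pow, add_mul, mul_assoc] using h

/-- Mixture representation of the distribution function of `|X+δ|` for logistic `X`: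
for `θ = e^δ/(1+e^δ)` and `x ≥ 0`,
`F(x-δ) - F(-x-δ) = Σ_{n=1}^∞ (θ(1-θ)^n + (1-θ)θ^n) (1-e^{-x})^n`. -/
theorem logistic_noncentral_mixture (δ : ℝ) (hδ : δ ≠ 0) (x : ℝ) (hx : 0 ≤ x) :
    (1 / (1 + Real.exp (-(x - δ))) - 1 / (1 + Real.exp (-(-x - δ)))) =
      ∑' n : ℕ,
        ((Real.exp δ / (1 + Real.exp δ)) * (1 - Real.exp δ / (1 + Real.exp δ)) ^ (n + 1) +
            (1 - Real.exp δ / (1 + Real.exp δ)) * (Real.exp δ / (1 + Real.exp δ)) ^ (n + 1)) *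
          (1 - Real.exp (-x)) ^ (n + 1) := by
  rw [(hasSum_geometric_mixture (exp_pos δ) (exp_pos (-x))
    (exp_le_one_iff.mpr (neg_nonpos.mpr hx))).tsum_eq]
  have h₁ : exp (-(x - δ)) = exp (-x) * exp δ := by rw [← exp_add]; congr 1; ring
  have h₂ : exp (-(-x - δ)) = exp δ / exp (-x) := by rw [← exp_sub]; congr 1; ring
  rw [h₁, h₂]
  have ht := exp_pos (-x)
  have hd := exp_pos δ
  generalize exp (-x) = t at ht ⊢
  generalize exp δ = d at hd ⊢
  field_simp
  ring
end

section
/- For every k ∈ ℕ₀: ∫₀^∞ ((e^x+e^{-x})/(e^{2x}+e^{-2x})) · ((e^x-e^{-x})²/(e^{2x}+e^{-2x}))^k dx = (π/2^{3/2}) · C(2k,k) / 4^k, where C(2k,k) is the central binomial coefficient. -/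
open Real

theorem integral_sin_pow_even_zero_pi_div_two (k : ℕ) :
    ∫ y in (0 : ℝ)..(π / 2), sin y ^ (2 * k) = π / 2 * (Nat.centralBinom k : ℝ) / 4 ^ k := by
  induction k with
  | zero => simp
  | succ k ih =>
    rw [show 2 * (k + 1) = 2 * k + 2 by ring, integral_sin_pow, ih]
    have h : ((k : ℝ) + 1) * (Nat.centralBinom (k + 1) : ℝ) =
        2 * (2 * k + 1) * (Nat.centralBinom k : ℝ) := by
      exact_mod_cast Nat.succ_mul_centralBinom_succ k
    have h' : (Nat.centralBinom (k + 1) : ℝ) =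
        2 * (2 * k + 1) * (Nat.centralBinom k : ℝ) / (k + 1) := by
      rw [← h]; field_simp
    rw [h']
    simp only [sin_zero, cos_pi_div_two, cos_zero]
    push_cast
    field_simp
    ring

theorem hasDerivAt_arctan_sqrt_two_mul_sinh (x : ℝ) :
    HasDerivAt (fun x ↦ arctan (√2 * sinh x)) (√2 * cosh x / (1 + 2 * sinh x ^ 2)) x := by
  convert! ((hasDerivAt_sinh x).const_mul (√2)).arctan using 1
  rw [mul_pow, sq_sqrt zero_le_two]
  ring

theorem sin_arctan_sqrt_two_mul_sinh_sq (x : ℝ) :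
    sin (arctan (√2 * sinh x)) ^ 2 = 2 * sinh x ^ 2 / (1 + 2 * sinh x ^ 2) := by
  rw [sin_arctan, div_pow, sq_sqrt (by positivity), mul_pow, sq_sqrt zero_le_two]

theorem exp_two_mul_add_exp_neg_two_mul (x : ℝ) :
    exp (2 * x) + exp (-(2 * x)) = 2 * (1 + 2 * sinh x ^ 2) := by
  have h := cosh_eq (2 * x)
  rw [cosh_two_mul, cosh_sq] at h
  linarith

theorem tendsto_sinh_atTop : Filter.Tendsto sinh Filter.atTop Filter.atTop :=
  Filter.tendsto_atTop_mono' _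
    (Filter.eventually_ge_atTop (0 : ℝ) |>.mono fun _ hx ↦ self_le_sinh_iff.2 hx) Filter.tendsto_id

/-- For every `k ∈ ℕ₀`:
`∫₀^∞ ((e^x+e^{-x})/(e^{2x}+e^{-2x})) ((e^x-e^{-x})²/(e^{2x}+e^{-2x}))^k dx
  = (π/2^{3/2}) C(2k,k)/4^k`. -/
theorem hyperbolicSecant_mixture_integral (k : ℕ) :
    ∫ x in Set.Ioi (0 : ℝ),
        ((Real.exp x + Real.exp (-x)) / (Real.exp (2 * x) + Real.exp (-(2 * x)))) *
          ((Real.exp x - Real.exp (-x)) ^ 2 / (Real.exp (2 * x) + Real.exp (-(2 * x)))) ^ k =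
      Real.pi / 2 ^ ((3 : ℝ) / 2) * (Nat.choose (2 * k) k : ℝ) / 4 ^ k := by
  have hcont : Continuous fun y : ℝ ↦ sin y ^ (2 * k) := by fun_prop
  set G : ℝ → ℝ := fun u ↦ ∫ y in (0 : ℝ)..u, sin y ^ (2 * k) with hG
  have hGd (u : ℝ) : HasDerivAt G (sin u ^ (2 * k)) u :=
    intervalIntegral.integral_hasDerivAt_right (hcont.intervalIntegrable _ _)
      hcont.aestronglyMeasurable.stronglyMeasurableAtFilter hcont.continuousAt
  have hderiv (x : ℝ) : HasDerivAt (fun x ↦ (√2)⁻¹ * G (arctan (√2 * sinh x)))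
      (((exp x + exp (-x)) / (exp (2 * x) + exp (-(2 * x)))) *
        ((exp x - exp (-x)) ^ 2 / (exp (2 * x) + exp (-(2 * x)))) ^ k) x := by
    convert! ((hGd _).comp x (hasDerivAt_arctan_sqrt_two_mul_sinh x)).const_mul (√2)⁻¹ using 1
    rw [pow_mul, sin_arctan_sqrt_two_mul_sinh_sq, exp_two_mul_add_exp_neg_two_mul,
      show exp x + exp (-x) = 2 * cosh x by rw [cosh_eq]; ring,
      show exp x - exp (-x) = 2 * sinh x by rw [sinh_eq]; ring,
      show (2 * sinh x) ^ 2 / (2 * (1 + 2 * sinh x ^ 2)) = 2 * sinh x ^ 2 / (1 + 2 * sinh x ^ 2) by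
        field_simp]
    field_simp
  have hlim : Filter.Tendsto (fun x ↦ (√2)⁻¹ * G (arctan (√2 * sinh x))) Filter.atTop
      (nhds ((√2)⁻¹ * G (π / 2))) :=
    ((hGd _).continuousAt.tendsto.comp <| (tendsto_arctan_atTop.mono_right nhdsWithin_le_nhds).comp
      (tendsto_sinh_atTop.const_mul_atTop (by positivity))).const_mul _
  rw [MeasureTheory.integral_Ioi_of_hasDerivAt_of_nonneg' (fun x _ ↦ hderiv x)
    (fun x _ ↦ by positivity) hlim]
  have h32 : (2 : ℝ) ^ ((3 : ℝ) / 2) = 2 * √2 := by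
    rw [show (3 : ℝ) / 2 = 1 + 1 / 2 by norm_num, rpow_add two_pos, rpow_one, sqrt_eq_rpow]
  have hG0 : G 0 = 0 := by simp [hG]
  rw [sinh_zero, mul_zero, arctan_zero, hG0, hG, h32]
  simp only [integral_sin_pow_even_zero_pi_div_two, Nat.centralBinom]
  field_simp
  ring
end

section
/- Let f(x) = 1/(π cosh x) be the density of the hyperbolic secant distribution, let δ ≠ 0 be real, and set θ = 2/(e^{-δ}+e^δ)². Then for all x > 0: f(x-δ) + f(x+δ) = Σ_{k=0}^∞ w_θ(k) · g_k(x), where w_θ(k) = (C(2k,k)/2^{2k}) (1-θ)^k θ^{1/2} and g_k(x) = (2^{2k+3/2}/(π C(2k,k))) · ((e^x+e^{-x})/(e^{2x}+e^{-2x})) · ((e^x-e^{-x})²/(e^{2x}+e^{-2x}))^k. -/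
open Real

/-- The mixture weights: negative binomial with parameters `1/2` and `θ`. -/
noncomputable def hypSecWeight (θ : ℝ) (k : ℕ) : ℝ :=
  ((Nat.choose (2 * k) k : ℝ) / 2 ^ (2 * k)) * (1 - θ) ^ k * θ ^ ((1 : ℝ) / 2)

/-- The mixture component densities for the noncentral hyperbolic secant distributions. -/
noncomputable def hypSecComponent (k : ℕ) (x : ℝ) : ℝ :=
  (2 ^ ((2 * k : ℝ) + 3 / 2) / (Real.pi * (Nat.choose (2 * k) k : ℝ))) *
    ((Real.exp x + Real.exp (-x)) / (Real.exp (2 * x) + Real.exp (-(2 * x)))) *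
      ((Real.exp x - Real.exp (-x)) ^ 2 / (Real.exp (2 * x) + Real.exp (-(2 * x)))) ^ k

/-- With `θ = 2/(e^{-δ}+e^δ)²`, the mixture terms form a geometric sequence. -/
theorem hypSecWeight_mul_hypSecComponent (δ x : ℝ) (k : ℕ) :
    hypSecWeight (2 / (Real.exp (-δ) + Real.exp δ) ^ 2) k * hypSecComponent k x =
      2 * Real.cosh x / (Real.pi * Real.cosh δ * Real.cosh (2 * x)) *
        (Real.cosh (2 * δ) * Real.sinh x ^ 2 / (Real.cosh δ ^ 2 * Real.cosh (2 * x))) ^ k := by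
  have hc := Real.cosh_pos δ
  have hC := Real.cosh_pos (2 * x)
  have hθ : 2 / (Real.exp (-δ) + Real.exp δ) ^ 2 = (√2 * Real.cosh δ)⁻¹ ^ 2 := by
    have h : Real.exp (-δ) + Real.exp δ = 2 * Real.cosh δ := by rw [Real.cosh_eq]; ring
    rw [h, inv_pow, mul_pow √2, Real.sq_sqrt zero_le_two]
    field_simp
  have hsqrt : ((√2 * Real.cosh δ)⁻¹ ^ 2) ^ ((1 : ℝ) / 2) = (√2 * Real.cosh δ)⁻¹ := by
    rw [← Real.sqrt_eq_rpow, Real.sqrt_sq (by positivity)]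
  have hone : 1 - (√2 * Real.cosh δ)⁻¹ ^ 2 = Real.cosh (2 * δ) / (2 * Real.cosh δ ^ 2) := by
    rw [inv_pow, mul_pow, Real.sq_sqrt zero_le_two, Real.cosh_two_mul, Real.sinh_sq]
    field_simp
    ring
  have hpow : (2 : ℝ) ^ ((2 * k : ℝ) + 3 / 2) = 2 ^ (2 * k) * (2 * √2) := by
    rw [Real.rpow_add two_pos, show (3 / 2 : ℝ) = 1 + 1 / 2 by norm_num, Real.rpow_add two_pos,
      Real.rpow_one, ← Real.sqrt_eq_rpow]
    norm_cast
  have hcosh (y : ℝ) : Real.exp y + Real.exp (-y) = 2 * Real.cosh y := by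
    rw [Real.cosh_eq]; ring
  have hsinh : Real.exp x - Real.exp (-x) = 2 * Real.sinh x := by
    rw [Real.sinh_eq]; ring
  have hchoose : (Nat.choose (2 * k) k : ℝ) ≠ 0 :=
    Nat.cast_ne_zero.2 (Nat.choose_pos (by omega)).ne'
  have hratio : Real.cosh (2 * δ) * Real.sinh x ^ 2 / (Real.cosh δ ^ 2 * Real.cosh (2 * x)) =
      Real.cosh (2 * δ) / (2 * Real.cosh δ ^ 2) *
        ((2 * Real.sinh x) ^ 2 / (2 * Real.cosh (2 * x))) := by
    field_simp
  rw [hypSecWeight, hypSecComponent, hθ, hsqrt, hone, hpow, hcosh, hcosh, hsinh, hratio,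
    mul_pow (Real.cosh (2 * δ) / (2 * Real.cosh δ ^ 2))]
  generalize (Real.cosh (2 * δ) / (2 * Real.cosh δ ^ 2)) ^ k = a
  generalize ((2 * Real.sinh x) ^ 2 / (2 * Real.cosh (2 * x))) ^ k = b
  field_simp

/-- Mixture representation of the density of `|X+δ|` for hyperbolic secant `X`:
with `θ = 2/(e^{-δ}+e^δ)²`, for `x > 0`,
`f(x-δ) + f(x+δ) = Σ_{k=0}^∞ w_θ(k) g_k(x)`. -/
theorem hyperbolicSecant_noncentral_mixture (δ : ℝ) (hδ : δ ≠ 0) (x : ℝ) (hx : 0 < x) :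
    1 / (Real.pi * Real.cosh (x - δ)) + 1 / (Real.pi * Real.cosh (x + δ)) =
      ∑' k : ℕ, hypSecWeight (2 / (Real.exp (-δ) + Real.exp δ) ^ 2) k * hypSecComponent k x := by
  have hc := Real.cosh_pos δ
  have hC := Real.cosh_pos (2 * x)
  have hsub := Real.cosh_pos (x - δ)
  have hadd := Real.cosh_pos (x + δ)
  have hprod : Real.cosh (x - δ) * Real.cosh (x + δ) =
      Real.cosh δ ^ 2 * Real.cosh (2 * x) - Real.cosh (2 * δ) * Real.sinh x ^ 2 := by
    rw [Real.cosh_sub, Real.cosh_add, Real.cosh_two_mul, Real.cosh_two_mul]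
    ring
  have hsum : Real.cosh (x - δ) + Real.cosh (x + δ) = 2 * Real.cosh x * Real.cosh δ := by
    rw [Real.cosh_sub, Real.cosh_add]
    ring
  have hpos := mul_pos hsub hadd
  have hδ2 := Real.cosh_pos (2 * δ)
  have hlt : Real.cosh (2 * δ) * Real.sinh x ^ 2 / (Real.cosh δ ^ 2 * Real.cosh (2 * x)) < 1 := by
    rw [div_lt_one (by positivity)]
    linarith
  have hone :
      1 - Real.cosh (2 * δ) * Real.sinh x ^ 2 / (Real.cosh δ ^ 2 * Real.cosh (2 * x)) =
        Real.cosh (x - δ) * Real.cosh (x + δ) / (Real.cosh δ ^ 2 * Real.cosh (2 * x)) := by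
    rw [hprod]
    field_simp
  have hlhs : 1 / (Real.pi * Real.cosh (x - δ)) + 1 / (Real.pi * Real.cosh (x + δ)) =
      (Real.cosh (x - δ) + Real.cosh (x + δ)) /
        (Real.pi * (Real.cosh (x - δ) * Real.cosh (x + δ))) := by
    field_simp
    ring
  simp_rw [hypSecWeight_mul_hypSecComponent]
  rw [tsum_mul_left, tsum_geometric_of_lt_one (by positivity) hlt, hone, hlhs, hsum]
  field_simp
end

section
/- For every k ∈ ℕ₀, if Z is a random variable with the Beta(1/2, k+1/2) distribution (density z ↦ z^{-1/2}(1-z)^{k-1/2}/B(1/2,k+1/2) on (0,1)), then the pushforward of its law under the map ψ(z) = (1/2)·arsech(z) = (1/2)·log((1+√(1-z²))/z) is absolutely continuous with density g_k(x) = (2^{2k+3/2}/(π C(2k,k))) · ((e^x+e^{-x})/(e^{2x}+e^{-2x})) · ((e^x-e^{-x})²/(e^{2x}+e^{-2x}))^k on (0,∞). -/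
open MeasureTheory Real

/-- The Beta(1/2, k+1/2) probability measure on (0,1), with density
`z ↦ z^{-1/2}(1-z)^{k-1/2} / B(1/2, k+1/2)`. -/
noncomputable def betaHalfMeasure (k : ℕ) : Measure ℝ :=
  volume.withDensity fun z =>
    ENNReal.ofReal (if z ∈ Set.Ioo (0 : ℝ) 1 then
      z ^ (-(1 : ℝ) / 2) * (1 - z) ^ ((k : ℝ) - 1 / 2) /
        (∫ y in Set.Ioo (0 : ℝ) 1, y ^ (-(1 : ℝ) / 2) * (1 - y) ^ ((k : ℝ) - 1 / 2))
    else 0)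

/-- `ψ(z) = (1/2) arsech z = (1/2) log((1+√(1-z²))/z)`. -/
noncomputable def halfArsech (z : ℝ) : ℝ :=
  (1 / 2) * Real.log ((1 + Real.sqrt (1 - z ^ 2)) / z)

theorem Gamma_half_mul_Gamma_nat_add_half (k : ℕ) :
    Real.Gamma (1 / 2) * Real.Gamma (k + 1 / 2) * 4 ^ k =
      Real.pi * (k.factorial : ℝ) * (Nat.centralBinom k : ℝ) := by
  induction k with
  | zero =>
    simp only [Nat.cast_zero, zero_add, Real.Gamma_one_half_eq, pow_zero, Nat.factorial_zero,
      Nat.centralBinom_zero, Nat.cast_one, mul_one]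
    exact Real.mul_self_sqrt Real.pi_pos.le
  | succ k ih =>
    have hrec : ((k : ℝ) + 1) * (Nat.centralBinom (k + 1) : ℝ) =
        2 * (2 * k + 1) * (Nat.centralBinom k : ℝ) := by
      exact_mod_cast Nat.succ_mul_centralBinom_succ k
    have hGamma : Real.Gamma (((k + 1 : ℕ) : ℝ) + 1 / 2) =
        (k + 1 / 2) * Real.Gamma (k + 1 / 2) := by
      rw [← Real.Gamma_add_one (by positivity)]
      push_cast
      ring_nf
    rw [hGamma, Nat.factorial_succ]
    push_cast
    linear_combination (4 * (k : ℝ) + 2) * ih - Real.pi * (k.factorial : ℝ) * hrec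

theorem setIntegral_Ioo_rpow_mul_one_sub_rpow {a b : ℝ} (ha : 0 < a) (hb : 0 < b) :
    ∫ y in Set.Ioo (0 : ℝ) 1, y ^ (a - 1) * (1 - y) ^ (b - 1) = ProbabilityTheory.beta a b := by
  rw [ProbabilityTheory.beta_eq_betaIntegralReal a b ha hb, Complex.betaIntegral,
    intervalIntegral.integral_of_le zero_le_one, ← integral_Ioc_eq_integral_Ioo,
    ← RCLike.re_to_complex, ← integral_re]
  · refine setIntegral_congr_fun measurableSet_Ioc fun x ⟨hx₁, hx₂⟩ ↦ ?_
    norm_cast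
    rw [← Complex.ofReal_cpow, ← Complex.ofReal_cpow, RCLike.re_to_complex,
      Complex.re_mul_ofReal, Complex.ofReal_re]
    all_goals linarith
  · convert! Complex.betaIntegral_convergent (u := a) (v := b) (by simpa) (by simpa)
    rw [intervalIntegrable_iff_integrableOn_Ioc_of_le (by simp), IntegrableOn]

theorem setIntegral_betaHalf (k : ℕ) :
    ∫ y in Set.Ioo (0 : ℝ) 1, y ^ (-(1 : ℝ) / 2) * (1 - y) ^ ((k : ℝ) - 1 / 2) =
      Real.pi * (Nat.choose (2 * k) k : ℝ) / 4 ^ k := by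
  have h := setIntegral_Ioo_rpow_mul_one_sub_rpow (a := 1 / 2) (b := (k : ℝ) + 1 / 2)
    (by norm_num) (by positivity)
  rw [show (1 / 2 : ℝ) - 1 = -1 / 2 by norm_num,
    show (k : ℝ) + 1 / 2 - 1 = k - 1 / 2 by ring] at h
  rw [h, ProbabilityTheory.beta, show (1 / 2 : ℝ) + (k + 1 / 2) = k + 1 by ring,
    Real.Gamma_nat_eq_factorial, ← Nat.centralBinom_eq_two_mul_choose,
    div_eq_div_iff (by positivity) (by positivity), Gamma_half_mul_Gamma_nat_add_half]
  ring

/-- The inverse `x ↦ sech (2 x)` of `halfArsech`. -/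
noncomputable def sechTwo (x : ℝ) : ℝ := 2 / (Real.exp (2 * x) + Real.exp (-(2 * x)))

theorem exp_two_mul_add_exp_neg (x : ℝ) :
    Real.exp (2 * x) + Real.exp (-(2 * x)) = Real.exp x ^ 2 + Real.exp (-x) ^ 2 := by
  rw [← Real.exp_nat_mul, ← Real.exp_nat_mul]
  push_cast
  ring_nf

theorem one_sub_sechTwo (x : ℝ) :
    1 - sechTwo x =
      (Real.exp x - Real.exp (-x)) ^ 2 / (Real.exp (2 * x) + Real.exp (-(2 * x))) := by
  have h : Real.exp x * Real.exp (-x) = 1 := by rw [← Real.exp_add]; simp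
  have hC : 0 < Real.exp (2 * x) + Real.exp (-(2 * x)) := by positivity
  rw [sechTwo, eq_div_iff hC.ne', sub_mul, div_mul_cancel₀ _ hC.ne', exp_two_mul_add_exp_neg]
  linear_combination 2 * h

theorem exp_neg_lt_exp {x : ℝ} (hx : 0 < x) : Real.exp (-x) < Real.exp x :=
  Real.exp_lt_exp.2 (by linarith)

theorem sechTwo_mem_Ioo {x : ℝ} (hx : 0 < x) : sechTwo x ∈ Set.Ioo (0 : ℝ) 1 := by
  refine ⟨by unfold sechTwo; positivity, ?_⟩
  have hd := sub_pos.2 (exp_neg_lt_exp hx)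
  have : 0 < 1 - sechTwo x := by rw [one_sub_sechTwo]; positivity
  linarith

theorem halfArsech_sechTwo {x : ℝ} (hx : 0 < x) : halfArsech (sechTwo x) = x := by
  have hd : 0 < Real.exp (2 * x) - Real.exp (-(2 * x)) :=
    sub_pos.2 (exp_neg_lt_exp (by linarith))
  have h : Real.exp (2 * x) * Real.exp (-(2 * x)) = 1 := by rw [← Real.exp_add]; simp
  have hC : 0 < Real.exp (2 * x) + Real.exp (-(2 * x)) := by positivity
  have hsqrt : Real.sqrt (1 - sechTwo x ^ 2) =
      (Real.exp (2 * x) - Real.exp (-(2 * x))) / (Real.exp (2 * x) + Real.exp (-(2 * x))) := by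
    rw [Real.sqrt_eq_iff_mul_self_eq_of_pos (by positivity), sechTwo]
    field_simp
    linear_combination -4 * h
  have harg : (1 + Real.sqrt (1 - sechTwo x ^ 2)) / sechTwo x = Real.exp (2 * x) := by
    rw [hsqrt, sechTwo]
    field_simp
    ring
  rw [halfArsech, harg, Real.log_exp]
  ring

theorem halfArsech_pos {z : ℝ} (hz : z ∈ Set.Ioo (0 : ℝ) 1) : 0 < halfArsech z := by
  have h : 1 < (1 + Real.sqrt (1 - z ^ 2)) / z := by
    rw [one_lt_div hz.1]
    linarith [Real.sqrt_nonneg (1 - z ^ 2), hz.2]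
  exact mul_pos (by norm_num) (Real.log_pos h)

theorem sechTwo_halfArsech {z : ℝ} (hz : z ∈ Set.Ioo (0 : ℝ) 1) :
    sechTwo (halfArsech z) = z := by
  obtain ⟨h0, h1⟩ := hz
  have hw := Real.sq_sqrt (show (0 : ℝ) ≤ 1 - z ^ 2 by nlinarith)
  have hw0 := Real.sqrt_nonneg (1 - z ^ 2)
  rw [sechTwo, halfArsech, ← mul_assoc, show (2 : ℝ) * (1 / 2) = 1 by norm_num, one_mul,
    Real.exp_neg, Real.exp_log (by positivity)]
  set w := Real.sqrt (1 - z ^ 2)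
  field_simp
  linear_combination -hw

theorem measurable_halfArsech : Measurable halfArsech := by
  unfold halfArsech
  fun_prop

theorem hasDerivAt_sechTwo (x : ℝ) :
    HasDerivAt sechTwo (-(4 * (Real.exp x + Real.exp (-x)) * (Real.exp x - Real.exp (-x)) /
      (Real.exp (2 * x) + Real.exp (-(2 * x))) ^ 2)) x := by
  have h₁ : HasDerivAt (fun y : ℝ => 2 * y) 2 x := by
    simpa using (hasDerivAt_id x).const_mul (2 : ℝ)
  have hC : Real.exp (2 * x) + Real.exp (-(2 * x)) ≠ 0 := by positivity
  have h := (hasDerivAt_const x (2 : ℝ)).fun_div (h₁.exp.fun_add h₁.fun_neg.exp) hC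
  refine h.congr_deriv ?_
  have e₁ : Real.exp (2 * x) = Real.exp x ^ 2 := by
    rw [← Real.exp_nat_mul]; norm_num
  have e₂ : Real.exp (-(2 * x)) = Real.exp (-x) ^ 2 := by
    rw [← Real.exp_nat_mul]; congr 1; push_cast; ring
  rw [← neg_div]
  congr 1
  rw [e₁, e₂]
  ring

theorem image_sechTwo_inter_Ioi (s : Set ℝ) :
    sechTwo '' (s ∩ Set.Ioi 0) = halfArsech ⁻¹' s ∩ Set.Ioo 0 1 := by
  ext z
  constructor
  · rintro ⟨x, ⟨hxs, hx⟩, rfl⟩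
    exact ⟨by rwa [Set.mem_preimage, halfArsech_sechTwo hx], sechTwo_mem_Ioo hx⟩
  · rintro ⟨hzs, hz⟩
    exact ⟨halfArsech z, ⟨hzs, halfArsech_pos hz⟩, sechTwo_halfArsech hz⟩

theorem abs_deriv_mul_betaHalf_density (k : ℕ) {x : ℝ} (hx : 0 < x) :
    |-(4 * (Real.exp x + Real.exp (-x)) * (Real.exp x - Real.exp (-x)) /
      (Real.exp (2 * x) + Real.exp (-(2 * x))) ^ 2)| *
      (sechTwo x ^ (-(1 : ℝ) / 2) * (1 - sechTwo x) ^ ((k : ℝ) - 1 / 2) /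
        (∫ y in Set.Ioo (0 : ℝ) 1, y ^ (-(1 : ℝ) / 2) * (1 - y) ^ ((k : ℝ) - 1 / 2))) =
      hypSecComponent k x := by
  obtain ⟨hz0, hz1⟩ := sechTwo_mem_Ioo hx
  have hz1' : 0 < 1 - sechTwo x := by linarith
  have hd := sub_pos.2 (exp_neg_lt_exp hx)
  have hs : 0 < Real.exp x + Real.exp (-x) := by positivity
  have hC : 0 < Real.exp (2 * x) + Real.exp (-(2 * x)) := by positivity
  have hch : (0 : ℝ) < Nat.choose (2 * k) k := by
    exact_mod_cast Nat.choose_pos (by omega)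
  have hsqrt : Real.sqrt (sechTwo x) * Real.sqrt (1 - sechTwo x) =
      Real.sqrt 2 * (Real.exp x - Real.exp (-x)) /
        (Real.exp (2 * x) + Real.exp (-(2 * x))) := by
    rw [← Real.sqrt_mul hz0.le, Real.sqrt_eq_iff_mul_self_eq_of_pos (by positivity),
      one_sub_sechTwo, sechTwo]
    have h2 := Real.mul_self_sqrt (show (0 : ℝ) ≤ 2 by norm_num)
    field_simp
    linear_combination h2
  have hpow : sechTwo x ^ (-(1 : ℝ) / 2) * (1 - sechTwo x) ^ ((k : ℝ) - 1 / 2) =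
      (1 - sechTwo x) ^ k / (Real.sqrt (sechTwo x) * Real.sqrt (1 - sechTwo x)) := by
    rw [neg_div, Real.rpow_neg hz0.le, Real.rpow_sub hz1', Real.rpow_natCast,
      ← Real.sqrt_eq_rpow, ← Real.sqrt_eq_rpow]
    field_simp
  have htwo : (2 : ℝ) ^ ((2 * k : ℝ) + 3 / 2) = 4 ^ k * (2 * Real.sqrt 2) := by
    rw [Real.rpow_add two_pos, Real.rpow_mul zero_le_two, Real.rpow_natCast,
      show (3 / 2 : ℝ) = 1 + 1 / 2 by norm_num, Real.rpow_add two_pos, Real.rpow_one,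
      ← Real.sqrt_eq_rpow]
    norm_num
  rw [abs_neg, abs_of_pos (by positivity), hpow, hsqrt, setIntegral_betaHalf, hypSecComponent,
    htwo, one_sub_sechTwo]
  have h2 := Real.sq_sqrt (show (0 : ℝ) ≤ 2 by norm_num)
  generalize ((Real.exp x - Real.exp (-x)) ^ 2 / (Real.exp (2 * x) + Real.exp (-(2 * x)))) ^ k = p
  generalize Real.exp (2 * x) + Real.exp (-(2 * x)) = C at *
  generalize Real.exp x + Real.exp (-x) = s at *
  generalize Real.exp x - Real.exp (-x) = d at *
  field_simp
  rw [h2]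
  ring

/-- If `Z` has the Beta(1/2, k+1/2) distribution, then `ψ(Z) = (1/2) arsech Z` has the
density `g_k` on `(0,∞)`. -/
theorem beta_pushforward_halfArsech (k : ℕ) :
    (betaHalfMeasure k).map halfArsech =
      volume.withDensity fun x =>
        ENNReal.ofReal (if 0 < x then hypSecComponent k x else 0) := by
  ext s hs
  have hpre := measurable_halfArsech hs
  rw [Measure.map_apply measurable_halfArsech hs, betaHalfMeasure, withDensity_apply _ hpre,
    withDensity_apply _ hs]
  set c := ∫ y in Set.Ioo (0 : ℝ) 1, y ^ (-(1 : ℝ) / 2) * (1 - y) ^ ((k : ℝ) - 1 / 2) with hc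
  have hL : ∀ z : ℝ, ENNReal.ofReal (if z ∈ Set.Ioo (0 : ℝ) 1 then
      z ^ (-(1 : ℝ) / 2) * (1 - z) ^ ((k : ℝ) - 1 / 2) / c else 0) =
      (Set.Ioo (0 : ℝ) 1).indicator (fun z => ENNReal.ofReal
        (z ^ (-(1 : ℝ) / 2) * (1 - z) ^ ((k : ℝ) - 1 / 2) / c)) z := by
    intro z
    by_cases hz : z ∈ Set.Ioo (0 : ℝ) 1
    · rw [if_pos hz, Set.indicator_of_mem hz]
    · rw [if_neg hz, Set.indicator_of_notMem hz, ENNReal.ofReal_zero]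
  have hR : ∀ x : ℝ, ENNReal.ofReal (if 0 < x then hypSecComponent k x else 0) =
      (Set.Ioi (0 : ℝ)).indicator (fun x => ENNReal.ofReal (hypSecComponent k x)) x := by
    intro x
    by_cases hx : 0 < x
    · rw [if_pos hx, Set.indicator_of_mem (Set.mem_Ioi.2 hx)]
    · rw [if_neg hx, Set.indicator_of_notMem (by simpa using hx), ENNReal.ofReal_zero]
  simp_rw [hL, hR]
  rw [setLIntegral_indicator measurableSet_Ioo, setLIntegral_indicator measurableSet_Ioi,
    Set.inter_comm, ← image_sechTwo_inter_Ioi, Set.inter_comm (Set.Ioi 0),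
    lintegral_image_eq_lintegral_abs_deriv_mul (hs.inter measurableSet_Ioi)
      (fun x _ => (hasDerivAt_sechTwo x).hasDerivWithinAt)
      (fun x hx y hy hxy => by
        rw [← halfArsech_sechTwo hx.2, hxy, halfArsech_sechTwo hy.2])]
  refine setLIntegral_congr_fun (hs.inter measurableSet_Ioi) fun x hx => ?_
  rw [← ENNReal.ofReal_mul (abs_nonneg _), hc, abs_deriv_mul_betaHalf_density k hx.2]
end

section
/- Let f(x) = 1/(π cosh x) be the density of the hyperbolic secant distribution, let δ ≠ 0 be real, and set θ = 2/(e^{-δ}+e^δ)². Then the pushforward of the hyperbolic secant probability measure under the map t ↦ (t+δ)² has density x ↦ Σ_{k=0}^∞ w_θ(k) · g̃_k(x) on (0,∞), where w_θ(k) = (C(2k,k)/2^{2k}) (1-θ)^k θ^{1/2}, g̃_k(x) = g_k(√x)/(2√x), and g_k(x) = (2^{2k+3/2}/(π C(2k,k))) · ((e^x+e^{-x})/(e^{2x}+e^{-2x})) · ((e^x-e^{-x})²/(e^{2x}+e^{-2x}))^k. -/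
open MeasureTheory Real

/-- The hyperbolic secant probability measure on ℝ, with density `x ↦ 1/(π cosh x)`. -/
noncomputable def hypSecMeasure : Measure ℝ :=
  volume.withDensity fun x => ENNReal.ofReal (1 / (Real.pi * Real.cosh x))

/-- The folded density: the sum of two translates of the hyperbolic secant density. -/
theorem hypSec_density_add (δ y : ℝ) :
    1 / (Real.pi * Real.cosh (y - δ)) + 1 / (Real.pi * Real.cosh (-y - δ)) =
      2 * Real.cosh y * Real.cosh δ / (Real.pi * (Real.cosh δ ^ 2 + Real.sinh y ^ 2)) := by
  have h1 := Real.cosh_pos (y - δ)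
  have h2 := Real.cosh_pos (y + δ)
  have h3 := Real.cosh_pos δ
  have hpi := Real.pi_pos
  have hprod : Real.cosh δ ^ 2 + Real.sinh y ^ 2 = Real.cosh (y - δ) * Real.cosh (y + δ) := by
    rw [Real.cosh_sub, Real.cosh_add]
    linear_combination (-Real.sinh y ^ 2) * Real.cosh_sq δ - Real.cosh δ ^ 2 * Real.cosh_sq y
  have hneg : Real.cosh (-y - δ) = Real.cosh (y + δ) := by
    rw [← Real.cosh_neg (y + δ)]
    ring_nf
  have hsum : Real.cosh (y - δ) + Real.cosh (y + δ) = 2 * Real.cosh y * Real.cosh δ := by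
    rw [Real.cosh_sub, Real.cosh_add]
    ring
  rw [hneg, hprod, ← hsum]
  field_simp
  ring

/-- The success parameter of the mixture weights, in terms of `cosh`. -/
theorem two_div_exp_add_exp_sq (δ : ℝ) :
    2 / (Real.exp (-δ) + Real.exp δ) ^ 2 = 1 / (2 * Real.cosh δ ^ 2) := by
  rw [Real.cosh_eq]
  have h : Real.exp (-δ) + Real.exp δ ≠ 0 := by positivity
  have h' : Real.exp δ + Real.exp (-δ) ≠ 0 := by positivity
  field_simp
  ring

/-- A weighted component, with the binomial coefficients cancelled. -/
theorem hypSecWeight_mul_component (δ y : ℝ) (k : ℕ) :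
    hypSecWeight (1 / (2 * Real.cosh δ ^ 2)) k * hypSecComponent k y =
      (2 * Real.cosh y / (Real.pi * Real.cosh δ * Real.cosh (2 * y))) *
        ((1 - 1 / (2 * Real.cosh δ ^ 2)) * (2 * Real.sinh y ^ 2 / Real.cosh (2 * y))) ^ k := by
  have hc : (0 : ℝ) < Nat.choose (2 * k) k := by
    exact_mod_cast Nat.choose_pos (by omega)
  have hδ := Real.cosh_pos δ
  have hpi := Real.pi_pos
  have h2y := Real.cosh_pos (2 * y)
  have e1 : Real.exp y + Real.exp (-y) = 2 * Real.cosh y := by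
    rw [Real.cosh_eq]; ring
  have e2 : Real.exp (2 * y) + Real.exp (-(2 * y)) = 2 * Real.cosh (2 * y) := by
    rw [Real.cosh_eq]; ring
  have e3 : Real.exp y - Real.exp (-y) = 2 * Real.sinh y := by
    rw [Real.sinh_eq]; ring
  have e4 : (2 * Real.sinh y) ^ 2 / (2 * Real.cosh (2 * y)) =
      2 * Real.sinh y ^ 2 / Real.cosh (2 * y) := by
    field_simp
  have e5 : (2 : ℝ) ^ ((2 * k : ℝ) + 3 / 2) = 2 ^ (2 * k) * (2 * Real.sqrt 2) := by
    rw [show (2 * k : ℝ) + 3 / 2 = ((2 * k : ℕ) : ℝ) + 1 + 1 / 2 by push_cast; ring,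
      Real.rpow_add two_pos, Real.rpow_add two_pos, Real.rpow_natCast, Real.rpow_one,
      Real.sqrt_eq_rpow, mul_assoc]
  have e6 : (1 / (2 * Real.cosh δ ^ 2)) ^ ((1 : ℝ) / 2) = 1 / (Real.sqrt 2 * Real.cosh δ) := by
    rw [← Real.sqrt_eq_rpow, Real.sqrt_div zero_le_one, Real.sqrt_one,
      Real.sqrt_mul zero_le_two, Real.sqrt_sq hδ.le]
  have hs : (0 : ℝ) < Real.sqrt 2 := by positivity
  unfold hypSecWeight hypSecComponent
  rw [e1, e2, e3, e4, e5, e6, mul_pow]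
  generalize (1 - 1 / (2 * Real.cosh δ ^ 2)) ^ k = a
  generalize (2 * Real.sinh y ^ 2 / Real.cosh (2 * y)) ^ k = b
  field_simp

/-- The mixture series is geometric and sums to the folded density. -/
theorem hasSum_hypSecWeight_mul_component (δ y : ℝ) :
    HasSum (fun k => hypSecWeight (1 / (2 * Real.cosh δ ^ 2)) k * hypSecComponent k y)
      (1 / (Real.pi * Real.cosh (y - δ)) + 1 / (Real.pi * Real.cosh (-y - δ))) := by
  simp_rw [hypSecWeight_mul_component, hypSec_density_add]
  have hδ := Real.one_le_cosh δ
  have hpi := Real.pi_pos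
  have h2 : Real.cosh (2 * y) = 1 + 2 * Real.sinh y ^ 2 := by
    rw [Real.cosh_two_mul, Real.cosh_sq]; ring
  have hd : 0 < 1 + 2 * Real.sinh y ^ 2 := by positivity
  have hθ1 : 1 / (2 * Real.cosh δ ^ 2) ≤ 1 := by
    rw [div_le_one (by positivity)]; nlinarith
  have hθ0 : 0 < 1 / (2 * Real.cosh δ ^ 2) := by positivity
  have hB0 : 0 ≤ 2 * Real.sinh y ^ 2 / Real.cosh (2 * y) := by positivity
  have hB1 : 2 * Real.sinh y ^ 2 / Real.cosh (2 * y) < 1 := by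
    rw [h2, div_lt_one hd]; linarith
  have hr := hasSum_geometric_of_lt_one (mul_nonneg (sub_nonneg.2 hθ1) hB0)
    (mul_lt_one_of_nonneg_of_lt_one_right (by linarith) hB0 hB1)
  have hs : 1 - (1 - 1 / (2 * Real.cosh δ ^ 2)) * (2 * Real.sinh y ^ 2 / Real.cosh (2 * y)) =
      (Real.cosh δ ^ 2 + Real.sinh y ^ 2) / (Real.cosh δ ^ 2 * Real.cosh (2 * y)) := by
    rw [h2]
    field_simp
    ring
  have hpos : 0 < Real.cosh δ ^ 2 + Real.sinh y ^ 2 := by positivity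
  have hlim : 2 * Real.cosh y * Real.cosh δ / (Real.pi * (Real.cosh δ ^ 2 + Real.sinh y ^ 2)) =
      2 * Real.cosh y / (Real.pi * Real.cosh δ * Real.cosh (2 * y)) *
        (1 - (1 - 1 / (2 * Real.cosh δ ^ 2)) *
          (2 * Real.sinh y ^ 2 / Real.cosh (2 * y)))⁻¹ := by
    rw [hs, h2]
    field_simp
  rw [hlim]
  exact hr.mul_left _

/-- Folding an integral over the line at the origin. -/
theorem lintegral_eq_lintegral_Ioi_add_neg {G : ℝ → ENNReal} (hG : Measurable G) :
    ∫⁻ t, G t = ∫⁻ y in Set.Ioi (0 : ℝ), (G y + G (-y)) := by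
  have hneg : ∫⁻ t in Set.Iic (0 : ℝ), G t = ∫⁻ y in Set.Ioi (0 : ℝ), G (-y) := by
    have h := (Measure.measurePreserving_neg (volume : Measure ℝ)).setLIntegral_comp_preimage
      (measurableSet_Iic (a := (0 : ℝ))) hG
    rw [← h, Set.neg_preimage, Set.neg_Iic, neg_zero]
    exact setLIntegral_congr Ioi_ae_eq_Ici.symm
  rw [lintegral_add_left hG, ← hneg, ← Set.compl_Ioi,
    lintegral_add_compl _ measurableSet_Ioi]

/-- The substitution `x = y²` on the positive half-line. -/
theorem lintegral_Ioi_eq_lintegral_sq (g : ℝ → ENNReal) :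
    ∫⁻ x in Set.Ioi (0 : ℝ), g x =
      ∫⁻ y in Set.Ioi (0 : ℝ), ENNReal.ofReal (2 * y) * g (y ^ 2) := by
  have himg : (fun y : ℝ => y ^ 2) '' Set.Ioi 0 = Set.Ioi 0 := by
    ext x
    constructor
    · rintro ⟨y, hy, rfl⟩
      exact pow_pos (Set.mem_Ioi.1 hy) 2
    · intro hx
      exact ⟨Real.sqrt x, Real.sqrt_pos.2 hx, Real.sq_sqrt (le_of_lt hx)⟩
  have hinj : Set.InjOn (fun y : ℝ => y ^ 2) (Set.Ioi 0) := fun a ha b hb hab =>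
    (sq_eq_sq₀ (le_of_lt ha) (le_of_lt hb)).1 hab
  have h := lintegral_image_eq_lintegral_abs_deriv_mul (s := Set.Ioi (0 : ℝ))
    (f := fun y : ℝ => y ^ 2) (f' := fun y => 2 * y) measurableSet_Ioi
    (fun y _ => by simpa using (hasDerivAt_pow 2 y).hasDerivWithinAt) hinj g
  rw [himg] at h
  rw [h]
  refine setLIntegral_congr_fun measurableSet_Ioi fun y hy => ?_
  have hy : 0 < y := hy
  simp only [abs_of_pos (mul_pos two_pos hy)]

/-- The pushforward of the hyperbolic secant measure under `t ↦ (t+δ)²` has density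
`x ↦ Σ_k w_θ(k) g̃_k(x)` on `(0,∞)`, where `g̃_k(x) = g_k(√x)/(2√x)` and
`θ = 2/(e^{-δ}+e^δ)²`. -/
theorem hyperbolicSecant_noncentral_sq_mixture (δ : ℝ) (hδ : δ ≠ 0) :
    hypSecMeasure.map (fun t : ℝ => (t + δ) ^ 2) =
      volume.withDensity fun x =>
        ENNReal.ofReal (if 0 < x then
          ∑' k : ℕ, hypSecWeight (2 / (Real.exp (-δ) + Real.exp δ) ^ 2) k *
            (hypSecComponent k (Real.sqrt x) / (2 * Real.sqrt x))
        else 0) := by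
  rw [two_div_exp_add_exp_sq]
  have hfm : Measurable fun x => ENNReal.ofReal (1 / (Real.pi * Real.cosh x)) := by
    have := Real.continuous_cosh.measurable
    fun_prop
  have hm : Measurable fun t : ℝ => (t + δ) ^ 2 := by fun_prop
  ext s hs
  rw [Measure.map_apply hm hs, hypSecMeasure, withDensity_apply _ (hm hs),
    withDensity_apply _ hs, ← lintegral_indicator (hm hs), ← lintegral_indicator hs,
    ← lintegral_sub_right_eq_self _ δ]
  refine (lintegral_eq_lintegral_Ioi_add_neg
    ((hfm.indicator (hm hs)).comp (measurable_id.sub_const δ))).trans ?_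
  set h : ℝ → ENNReal := s.indicator _ with hh
  have hsupp : ∫⁻ x, h x = ∫⁻ x in Set.Ioi 0, h x := by
    rw [← lintegral_indicator measurableSet_Ioi, Set.indicator_eq_self.2]
    intro x hx
    by_contra hx0
    refine hx ?_
    have hx0' : ¬ 0 < x := hx0
    simp [hh, Set.indicator, hx0']
  rw [hsupp, lintegral_Ioi_eq_lintegral_sq h]
  refine setLIntegral_congr_fun measurableSet_Ioi fun y hy => ?_
  have hy : 0 < y := hy
  have hy2 : 0 < y ^ 2 := by positivity
  by_cases hys : y ^ 2 ∈ s
  · have hval : ∑' k : ℕ, hypSecWeight (1 / (2 * Real.cosh δ ^ 2)) k *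
        (hypSecComponent k y / (2 * y)) =
        (1 / (Real.pi * Real.cosh (y - δ)) + 1 / (Real.pi * Real.cosh (-y - δ))) / (2 * y) := by
      simp_rw [← mul_div_assoc]
      exact ((hasSum_hypSecWeight_mul_component δ y).div_const (2 * y)).tsum_eq
    have hpos (t : ℝ) : 0 ≤ 1 / (Real.pi * Real.cosh t) := by positivity
    simp only [hh, Function.comp_apply, id_eq, Set.indicator, Set.mem_preimage, sub_add_cancel, neg_sq, hys, hy2, if_true,
      Real.sqrt_sq hy.le, hval]
    rw [← ENNReal.ofReal_mul (by positivity), mul_div_cancel₀ _ (by positivity),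
      ENNReal.ofReal_add (hpos _) (hpos _)]
  · simp [hh, hys]
end

section
/- Suppose that for each η > 0, m_η is a probability mass function on ℕ₀, and for each n ∈ ℕ₀, c_n is a probability mass function on ℕ₀, such that e^{-η} η^k / k! = Σ_{n=0}^∞ m_η(n) c_n(k) for all k ∈ ℕ₀ and all η > 0. Then for every real δ ≠ 0, with η = δ²/2, one has for all x > 0: (1/√(2πx)) · e^{-(x+δ²)/2} · cosh(δ√x) = Σ_{n=0}^∞ m_η(n) · Σ_{k=0}^∞ c_n(k) · g_{2k+1}(x); that is, every mixture representation of the Poisson family yields a mixture representation of the noncentral chi-squared distributions with one degree of freedom. -/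
/-- The density of the chi-squared distribution with `2k+1` degrees of freedom. -/
noncomputable def chiSqOddDensity (k : ℕ) (x : ℝ) : ℝ :=
  x ^ ((k : ℝ) - 1 / 2) * Real.exp (-x / 2) /
    (2 ^ ((k : ℝ) + 1 / 2) * Real.Gamma ((k : ℝ) + 1 / 2))

theorem Real.Gamma_nat_add_half_mul_factorial (k : ℕ) :
    Real.Gamma ((k : ℝ) + 1 / 2) * k.factorial * 4 ^ k =
      (2 * k).factorial * Real.sqrt Real.pi := by
  have h := Real.Gamma_mul_Gamma_add_half ((k : ℝ) + 1 / 2)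
  have h1 : (k : ℝ) + 1 / 2 + 1 / 2 = (k : ℝ) + 1 := by ring
  have h2 : 2 * ((k : ℝ) + 1 / 2) = ((2 * k : ℕ) : ℝ) + 1 := by push_cast; ring
  have h3 : 1 - (((2 * k : ℕ) : ℝ) + 1) = -((2 * k : ℕ) : ℝ) := by ring
  rw [h1, h2, h3, Real.Gamma_nat_eq_factorial, Real.Gamma_nat_eq_factorial,
    Real.rpow_neg two_pos.le, Real.rpow_natCast, pow_mul] at h
  norm_num only at h
  rw [h]
  field_simp

/-- The density of the chi-squared distribution with `2k+1` degrees of freedom, written with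
natural powers and factorials. -/
theorem chiSqOddDensity_eq (k : ℕ) {x : ℝ} (hx : 0 < x) :
    chiSqOddDensity k x = 1 / Real.sqrt (2 * Real.pi * x) * Real.exp (-x / 2) *
      ((2 * x) ^ k * k.factorial / (2 * k).factorial) := by
  have hG : 0 < Real.Gamma ((k : ℝ) + 1 / 2) := Real.Gamma_pos_of_pos (by positivity)
  have h := Real.Gamma_nat_add_half_mul_factorial k
  have h4 : (4 : ℝ) ^ k = 2 ^ k * 2 ^ k := by rw [← mul_pow]; norm_num
  have hpi := Real.pi_pos
  rw [h4] at h
  unfold chiSqOddDensity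
  rw [Real.rpow_sub hx, Real.rpow_add two_pos, Real.rpow_natCast, Real.rpow_natCast,
    ← Real.sqrt_eq_rpow, ← Real.sqrt_eq_rpow, Real.sqrt_mul (by positivity),
    Real.sqrt_mul two_pos.le, mul_pow]
  generalize Real.Gamma ((k : ℝ) + 1 / 2) = G at hG h ⊢
  field_simp
  linear_combination -h

theorem chiSqOddDensity_nonneg (k : ℕ) {x : ℝ} (hx : 0 < x) : 0 ≤ chiSqOddDensity k x := by
  rw [chiSqOddDensity_eq k hx]
  positivity

/-- The noncentral chi-squared density with one degree of freedom is the Poisson mixture of the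
chi-squared densities with odd degrees of freedom. -/
theorem hasSum_poisson_mul_chiSqOddDensity (δ : ℝ) {x : ℝ} (hx : 0 < x) :
    HasSum (fun k : ℕ ↦ Real.exp (-(δ ^ 2 / 2)) * (δ ^ 2 / 2) ^ k / k.factorial *
        chiSqOddDensity k x)
      ((1 / Real.sqrt (2 * Real.pi * x)) * Real.exp (-(x + δ ^ 2) / 2) *
        Real.cosh (δ * Real.sqrt x)) := by
  refine ((Real.hasSum_cosh (δ * Real.sqrt x)).mul_left _).congr_fun fun k ↦ ?_
  have hexp : Real.exp (-(x + δ ^ 2) / 2) = Real.exp (-(δ ^ 2 / 2)) * Real.exp (-x / 2) := by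
    rw [← Real.exp_add]; ring_nf
  have hpow : (δ * Real.sqrt x) ^ (2 * k) = (δ ^ 2 / 2) ^ k * (2 * x) ^ k := by
    rw [pow_mul, mul_pow, Real.sq_sqrt hx.le, ← mul_pow]; ring_nf
  rw [chiSqOddDensity_eq k hx, hexp, hpow]
  field_simp

/-- Sums of nonnegative terms may be interchanged when the iterated sum converges. -/
theorem tsum_comm_of_nonneg {α β : Type*} {f : α → β → ℝ} (hf : ∀ a b, 0 ≤ f a b)
    (h₁ : ∀ a, Summable (f a)) (h₂ : Summable fun a ↦ ∑' b, f a b) :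
    ∑' b, ∑' a, f a b = ∑' a, ∑' b, f a b :=
  Summable.tsum_comm ((summable_prod_of_nonneg (f := Function.uncurry f)
    fun p ↦ hf p.1 p.2).2 ⟨h₁, h₂⟩)

/-- Every mixture representation of the Poisson family yields a mixture representation of
the noncentral chi-squared distributions with one degree of freedom. -/
theorem poisson_mixture_to_noncentral_chiSq_mixture
    (m : ℝ → ℕ → ℝ) (c : ℕ → ℕ → ℝ)
    (hm_nonneg : ∀ η : ℝ, 0 < η → ∀ n, 0 ≤ m η n)
    (hm_sum : ∀ η : ℝ, 0 < η → ∑' n, m η n = 1)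
    (hc_nonneg : ∀ n k, 0 ≤ c n k)
    (hc_sum : ∀ n, ∑' k, c n k = 1)
    (hmix : ∀ η : ℝ, 0 < η → ∀ k : ℕ,
      Real.exp (-η) * η ^ k / Nat.factorial k = ∑' n, m η n * c n k)
    (δ : ℝ) (hδ : δ ≠ 0) (x : ℝ) (hx : 0 < x) :
    (1 / Real.sqrt (2 * Real.pi * x)) * Real.exp (-(x + δ ^ 2) / 2) *
        Real.cosh (δ * Real.sqrt x) =
      ∑' n : ℕ, m (δ ^ 2 / 2) n * ∑' k : ℕ, c n k * chiSqOddDensity k x := by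
  have hη : 0 < δ ^ 2 / 2 := by positivity
  have hsum := hasSum_poisson_mul_chiSqOddDensity δ hx
  simp only [hmix _ hη, ← tsum_mul_right, mul_assoc (m _ _)] at hsum
  have hm : Summable (m (δ ^ 2 / 2)) := by
    by_contra h
    simpa [tsum_eq_zero_of_not_summable h] using hm_sum _ hη
  have hc : ∀ n k, c n k ≤ 1 := fun n k ↦ by
    have h : Summable (c n) := by
      by_contra h
      simpa [tsum_eq_zero_of_not_summable h] using hc_sum n
    exact (h.le_tsum k fun j _ ↦ hc_nonneg n j).trans_eq (hc_sum n)
  have hg := fun k ↦ chiSqOddDensity_nonneg k hx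
  have hnonneg : ∀ k n, 0 ≤ m (δ ^ 2 / 2) n * (c n k * chiSqOddDensity k x) := fun k n ↦
    mul_nonneg (hm_nonneg _ hη n) (mul_nonneg (hc_nonneg n k) (hg k))
  have hsummable : ∀ k, Summable fun n ↦ m (δ ^ 2 / 2) n * (c n k * chiSqOddDensity k x) :=
    fun k ↦ (hm.mul_right (chiSqOddDensity k x)).of_nonneg_of_le (hnonneg k) fun n ↦
      mul_le_mul_of_nonneg_left (mul_le_of_le_one_left (hg k) (hc n k)) (hm_nonneg _ hη n)
  simp_rw [← tsum_mul_left]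
  rw [tsum_comm_of_nonneg hnonneg hsummable hsum.summable, hsum.tsum_eq]
end

section
/- The uniform distribution on [0,1] does not belong to the closure, in total variation distance, of the convex hull of the family {χ²_{2k+1} : k ∈ ℕ₀} of chi-squared distributions with odd degrees of freedom; equivalently, the density 1_{[0,1]} is not an L¹-limit of countable convex combinations Σ_k a_k g_{2k+1} with a_k ≥ 0, Σ_k a_k = 1. -/
open MeasureTheory Real

/-- The density of the chi-squared distribution with `2k+1` degrees of freedom, extended
by `0` to the whole real line. -/
noncomputable def chiSqOddDensity' (k : ℕ) (x : ℝ) : ℝ :=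
  if 0 < x then
    x ^ ((k : ℝ) - 1 / 2) * Real.exp (-x / 2) /
      (2 ^ ((k : ℝ) + 1 / 2) * Real.Gamma ((k : ℝ) + 1 / 2))
  else 0

open ProbabilityTheory in
lemma chiSqOddDensity'_eq_gammaPDFReal (k : ℕ) :
    chiSqOddDensity' k = gammaPDFReal ((k : ℝ) + 1 / 2) (1 / 2) := by
  ext x
  rcases lt_trichotomy x 0 with hx | rfl | hx
  · simp [chiSqOddDensity', gammaPDFReal, hx.not_gt, hx.not_ge]
  · have hk : (k : ℝ) + 1 / 2 - 1 ≠ 0 := by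
      intro h
      have h' : ((2 * k : ℕ) : ℝ) = ((1 : ℕ) : ℝ) := by push_cast; linarith
      have := Nat.cast_injective h'
      omega
    simp only [chiSqOddDensity', gammaPDFReal, lt_irrefl, le_refl, if_true, if_false]
    rw [Real.zero_rpow hk]
    simp
  · simp only [chiSqOddDensity', gammaPDFReal, hx, hx.le, if_true]
    rw [Real.div_rpow zero_le_one zero_le_two, Real.one_rpow,
      show (k : ℝ) + 1 / 2 - 1 = k - 1 / 2 by ring, show -x / 2 = -(1 / 2 * x) by ring]
    have : Real.Gamma ((k : ℝ) + 1 / 2) ≠ 0 := (Real.Gamma_pos_of_pos (by positivity)).ne'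
    field_simp

lemma chiSqOddDensity'_nonneg (k : ℕ) (x : ℝ) : 0 ≤ chiSqOddDensity' k x := by
  rw [chiSqOddDensity'_eq_gammaPDFReal]
  exact ProbabilityTheory.gammaPDFReal_nonneg (by positivity) (by norm_num) x

lemma measurable_chiSqOddDensity' (k : ℕ) : Measurable (chiSqOddDensity' k) := by
  rw [chiSqOddDensity'_eq_gammaPDFReal]
  fun_prop

lemma lintegral_chiSqOddDensity' (k : ℕ) :
    ∫⁻ x, ENNReal.ofReal (chiSqOddDensity' k x) = 1 := by
  rw [chiSqOddDensity'_eq_gammaPDFReal]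
  exact ProbabilityTheory.lintegral_gammaPDF_eq_one (by positivity) (by norm_num)

/-- After multiplication by `√x * exp (x / 2)` the density is monotone; this is the resulting
comparison between the points `x` and `x + 1`. -/
lemma chiSqOddDensity'_le_add_one (k : ℕ) {x : ℝ} (hx : 1 / 2 ≤ x) :
    chiSqOddDensity' k x ≤ 4 * chiSqOddDensity' k (x + 1) := by
  have hx0 : 0 < x := by linarith
  have hx1 : 0 < x + 1 := by linarith
  have hG : 0 < Real.Gamma ((k : ℝ) + 1 / 2) := Real.Gamma_pos_of_pos (by positivity)
  simp only [chiSqOddDensity', hx0, hx1, if_true]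
  rw [← mul_div_assoc]
  refine div_le_div_of_nonneg_right ?_ (by positivity)
  have hsqrt : x ^ (-(1 / 2) : ℝ) ≤ 2 * (x + 1) ^ (-(1 / 2) : ℝ) := by
    rw [Real.rpow_neg hx0.le, Real.rpow_neg hx1.le, ← Real.sqrt_eq_rpow, ← Real.sqrt_eq_rpow,
      ← div_eq_mul_inv, inv_eq_one_div, div_le_div_iff₀ (by positivity) (by positivity), one_mul]
    calc √(x + 1) ≤ √(2 ^ 2 * x) := Real.sqrt_le_sqrt (by linarith)
      _ = 2 * √x := by rw [Real.sqrt_mul (by positivity), Real.sqrt_sq zero_le_two]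
  have hexp : Real.exp (-x / 2) ≤ 2 * Real.exp (-(x + 1) / 2) := by
    have h2 : Real.exp (1 / 2) ≤ 2 := by
      rw [← Real.le_log_iff_exp_le two_pos]
      linarith [Real.log_two_gt_d9]
    rw [show -x / 2 = 1 / 2 + -(x + 1) / 2 by ring, Real.exp_add]
    gcongr
  have hpow : x ^ ((k : ℝ) - 1 / 2) ≤ 2 * (x + 1) ^ ((k : ℝ) - 1 / 2) := by
    rw [sub_eq_add_neg, Real.rpow_add hx0, Real.rpow_add hx1, Real.rpow_natCast, Real.rpow_natCast]
    calc x ^ k * x ^ (-(1 / 2) : ℝ)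
        ≤ (x + 1) ^ k * (2 * (x + 1) ^ (-(1 / 2) : ℝ)) := by gcongr; linarith
      _ = _ := by ring
  calc x ^ ((k : ℝ) - 1 / 2) * Real.exp (-x / 2)
      ≤ (2 * (x + 1) ^ ((k : ℝ) - 1 / 2)) * (2 * Real.exp (-(x + 1) / 2)) := by gcongr
    _ = 4 * ((x + 1) ^ ((k : ℝ) - 1 / 2) * Real.exp (-(x + 1) / 2)) := by ring

section Mixture

variable {a : ℕ → ℝ}

lemma lintegral_mixture_ne_top (ha : ∀ k, 0 ≤ a k) (hs : Summable a) :
    ∫⁻ x, ∑' k, ENNReal.ofReal (a k * chiSqOddDensity' k x) ≠ ⊤ := by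
  rw [lintegral_tsum fun k =>
    ((measurable_chiSqOddDensity' k).const_mul (a k)).ennreal_ofReal.aemeasurable]
  have h (k : ℕ) : ∫⁻ x, ENNReal.ofReal (a k * chiSqOddDensity' k x) = ENNReal.ofReal (a k) := by
    simp_rw [ENNReal.ofReal_mul (ha k)]
    rw [lintegral_const_mul _ (measurable_chiSqOddDensity' k).ennreal_ofReal,
      lintegral_chiSqOddDensity', mul_one]
  simp_rw [h]
  exact hs.tsum_ofReal_ne_top

lemma measurable_mixture_ofReal (a : ℕ → ℝ) :
    Measurable fun x => ∑' k, ENNReal.ofReal (a k * chiSqOddDensity' k x) :=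
  Measurable.tsum fun k => ((measurable_chiSqOddDensity' k).const_mul (a k)).ennreal_ofReal

lemma toReal_mixture_term (ha : ∀ k, 0 ≤ a k) (k : ℕ) (x : ℝ) :
    (ENNReal.ofReal (a k * chiSqOddDensity' k x)).toReal = a k * chiSqOddDensity' k x :=
  ENNReal.toReal_ofReal (mul_nonneg (ha k) (chiSqOddDensity'_nonneg k x))

lemma integrable_mixture (ha : ∀ k, 0 ≤ a k) (hs : Summable a) :
    Integrable fun x => ∑' k, a k * chiSqOddDensity' k x := by
  have h := integrable_toReal_of_lintegral_ne_top (measurable_mixture_ofReal a).aemeasurable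
    (lintegral_mixture_ne_top ha hs)
  simpa only [ENNReal.tsum_toReal_eq fun _ => ENNReal.ofReal_ne_top, toReal_mixture_term ha] using h

lemma ae_summable_mixture (ha : ∀ k, 0 ≤ a k) (hs : Summable a) :
    ∀ᵐ x : ℝ, Summable fun k => a k * chiSqOddDensity' k x := by
  filter_upwards [ae_lt_top (measurable_mixture_ofReal a) (lintegral_mixture_ne_top ha hs)]
    with x hx
  simpa only [toReal_mixture_term ha] using ENNReal.summable_toReal hx.ne

lemma mixture_le_add_one (ha : ∀ k, 0 ≤ a k) {x : ℝ} (hx : 1 / 2 ≤ x)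
    (hs : Summable fun k => a k * chiSqOddDensity' k (x + 1)) :
    ∑' k, a k * chiSqOddDensity' k x ≤ 4 * ∑' k, a k * chiSqOddDensity' k (x + 1) := by
  have hle (k : ℕ) : a k * chiSqOddDensity' k x ≤ 4 * (a k * chiSqOddDensity' k (x + 1)) := by
    rw [mul_left_comm]
    exact mul_le_mul_of_nonneg_left (chiSqOddDensity'_le_add_one k hx) (ha k)
  rw [← tsum_mul_left]
  exact (Summable.of_nonneg_of_le (fun k => mul_nonneg (ha k) (chiSqOddDensity'_nonneg k x))
    hle (hs.mul_left 4)).tsum_le_tsum hle (hs.mul_left 4)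

lemma integral_abs_uniform_sub_mixture_ge (ha : ∀ k, 0 ≤ a k) (hs : Summable a) :
    1 / 16 ≤ ∫ x : ℝ, |Set.indicator (Set.Icc (0 : ℝ) 1) (fun _ => (1 : ℝ)) x -
      ∑' k : ℕ, a k * chiSqOddDensity' k x| := by
  set G : ℝ → ℝ := fun x => |Set.indicator (Set.Icc (0 : ℝ) 1) (fun _ => (1 : ℝ)) x -
      ∑' k : ℕ, a k * chiSqOddDensity' k x| with hGdef
  have hG : Integrable G :=
    (((integrable_indicator_iff measurableSet_Icc).2
      (integrableOn_const (by simp))).sub (integrable_mixture ha hs)).abs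
  have hG0 (x : ℝ) : 0 ≤ G x := abs_nonneg _
  have hG1 : Integrable fun x => G (x + 1) := hG.comp_add_right 1
  have hsum : ∀ᵐ x : ℝ, Summable fun k => a k * chiSqOddDensity' k (x + 1) :=
    (measurePreserving_add_right volume (1 : ℝ)).quasiMeasurePreserving.ae
      (ae_summable_mixture ha hs)
  have hind : Integrable ((Set.Ioc (1 / 2 : ℝ) 1).indicator fun _ => (1 / 4 : ℝ)) :=
    (integrable_indicator_iff measurableSet_Ioc).2 (integrableOn_const (by simp))
  have hle : ∫ x, (Set.Ioc (1 / 2 : ℝ) 1).indicator (fun _ => (1 / 4 : ℝ)) x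
      ≤ ∫ x, (G x + G (x + 1)) := by
    refine integral_mono_ae hind (hG.add hG1) ?_
    filter_upwards [hsum] with x hx
    by_cases hmem : x ∈ Set.Ioc (1 / 2 : ℝ) 1
    · have hx1 : x ∈ Set.Icc (0 : ℝ) 1 := ⟨by linarith [hmem.1], hmem.2⟩
      have hx2 : x + 1 ∉ Set.Icc (0 : ℝ) 1 := fun h => by linarith [hmem.1, h.2]
      have hm := mixture_le_add_one ha hmem.1.le hx
      simp only [hGdef, Set.indicator_of_mem hmem, Set.indicator_of_mem hx1,
        Set.indicator_of_notMem hx2, zero_sub, abs_neg]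
      linarith [le_abs_self (1 - ∑' k, a k * chiSqOddDensity' k x),
        le_abs_self (∑' k, a k * chiSqOddDensity' k (x + 1)),
        abs_nonneg (1 - ∑' k, a k * chiSqOddDensity' k x)]
    · rw [Set.indicator_of_notMem hmem]
      exact add_nonneg (hG0 x) (hG0 (x + 1))
  rw [integral_add hG hG1, integral_add_right_eq_self G 1, integral_indicator measurableSet_Ioc,
    setIntegral_const, Real.volume_real_Ioc_of_le (by norm_num)] at hle
  norm_num at hle
  linarith

end Mixture

/-- The uniform distribution on `[0,1]` is not an L¹-limit (equivalently, not a limit in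
total variation) of countable convex combinations of the chi-squared distributions with
odd degrees of freedom. -/
theorem uniform_not_in_closed_convexHull_of_chiSqOdd :
    ¬ (∀ ε : ℝ, 0 < ε → ∃ a : ℕ → ℝ, (∀ k, 0 ≤ a k) ∧ (∑' k, a k) = 1 ∧
        (∫ x : ℝ,
          |Set.indicator (Set.Icc (0 : ℝ) 1) (fun _ => (1 : ℝ)) x -
            ∑' k : ℕ, a k * chiSqOddDensity' k x|) < ε) := by
  intro h
  obtain ⟨a, ha, h1, hlt⟩ := h (1 / 16) (by norm_num)
  have hs : Summable a := by
    by_contra hs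
    simp [tsum_eq_zero_of_not_summable hs] at h1
  exact hlt.not_ge (integral_abs_uniform_sub_mixture_ge ha hs)
end
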